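/- Let B(x) = max_{i∈[k]} (c_iᵀx − d_i) be a polyhedral function on ℝⁿ, let (A_l, b_l), l ∈ [m], be the modes of a switched affine system, and let λ ≥ 0. For every mode l ∈ [m], the set {x ∈ ℝⁿ : B(x) ≤ 0 and M(x,l) ≥ M(x,l') for all l' ∈ [m]} is closed in ℝⁿ, where M is the merit function. (This is the closedness, on the region {B ≤ 0}, of the preimage σ^{-1}(l) of the switching rule σ(x) = argmax_{l∈[m]} M(x,l).) -/

import Mathlib

open Finset Matrix

/-- The polyhedral (pointwise-maximum) function `B(x) = max_{i∈[k]} (cᵢᵀx − dᵢ)`. -/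
noncomputable def Bmax {n k : ℕ} [NeZero k] (c : Fin k → Fin n → ℝ) (d : Fin k → ℝ)
    (x : Fin n → ℝ) : ℝ :=
  Finset.univ.sup' Finset.univ_nonempty fun i => c i ⬝ᵥ x - d i

/-- The piecewise merit value
`Mᵢ(x,l) = sup{τ ≥ 0 : τ·φ̂ᵢ + φᵢ + λτ·φᵢ − φ ≤ −τ²}`. -/
noncomputable def meritPiece {n k m : ℕ} [NeZero k] (c : Fin k → Fin n → ℝ) (d : Fin k → ℝ)
    (A : Fin m → Matrix (Fin n) (Fin n) ℝ) (b : Fin m → Fin n → ℝ) (lam : ℝ)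
    (x : Fin n → ℝ) (l : Fin m) (i : Fin k) : ℝ :=
  sSup {τ : ℝ | 0 ≤ τ ∧
    τ * (c i ⬝ᵥ (A l *ᵥ x + b l)) + (c i ⬝ᵥ x - d i) + lam * τ * (c i ⬝ᵥ x - d i)
      - Bmax c d x ≤ -τ ^ 2}

/-- The merit function `M(x,l) = min_{i∈[k]} Mᵢ(x,l)`. -/
noncomputable def merit {n k m : ℕ} [NeZero k] (c : Fin k → Fin n → ℝ) (d : Fin k → ℝ)
    (A : Fin m → Matrix (Fin n) (Fin n) ℝ) (b : Fin m → Fin n → ℝ) (lam : ℝ)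
    (x : Fin n → ℝ) (l : Fin m) : ℝ :=
  Finset.univ.inf' Finset.univ_nonempty fun i => meritPiece c d A b lam x l i

theorem sSup_quadratic_nonpos (p : ℝ) {q : ℝ} (hq : 0 ≤ q) :
    sSup {τ : ℝ | 0 ≤ τ ∧ τ ^ 2 + p * τ - q ≤ 0} = (√(p ^ 2 + 4 * q) - p) / 2 := by
  have hs : √(p ^ 2 + 4 * q) ^ 2 = p ^ 2 + 4 * q := Real.sq_sqrt (by positivity)
  apply IsGreatest.csSup_eq
  refine ⟨⟨?_, by nlinarith⟩, fun τ ⟨_, hτ⟩ => ?_⟩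
  · linarith [Real.le_sqrt_of_sq_le (show p ^ 2 ≤ p ^ 2 + 4 * q by linarith)]
  · linarith [Real.le_sqrt_of_sq_le (show (2 * τ + p) ^ 2 ≤ p ^ 2 + 4 * q by nlinarith)]

theorem le_Bmax {n k : ℕ} [NeZero k] (c : Fin k → Fin n → ℝ) (d : Fin k → ℝ)
    (x : Fin n → ℝ) (i : Fin k) : c i ⬝ᵥ x - d i ≤ Bmax c d x :=
  Finset.le_sup' (fun i => c i ⬝ᵥ x - d i) (Finset.mem_univ i)

theorem continuous_Bmax {n k : ℕ} [NeZero k] (c : Fin k → Fin n → ℝ) (d : Fin k → ℝ) :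
    Continuous (Bmax c d) :=
  Continuous.finset_sup'_apply _ fun _ _ =>
    (continuous_const.dotProduct continuous_id).sub continuous_const

theorem meritPiece_eq {n k m : ℕ} [NeZero k] (c : Fin k → Fin n → ℝ) (d : Fin k → ℝ)
    (A : Fin m → Matrix (Fin n) (Fin n) ℝ) (b : Fin m → Fin n → ℝ) (lam : ℝ)
    (x : Fin n → ℝ) (l : Fin m) (i : Fin k) :
    meritPiece c d A b lam x l i =
      (√((c i ⬝ᵥ (A l *ᵥ x + b l) + lam * (c i ⬝ᵥ x - d i)) ^ 2
          + 4 * (Bmax c d x - (c i ⬝ᵥ x - d i)))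
        - (c i ⬝ᵥ (A l *ᵥ x + b l) + lam * (c i ⬝ᵥ x - d i))) / 2 := by
  rw [← sSup_quadratic_nonpos _ (sub_nonneg.2 (le_Bmax c d x i)), meritPiece]
  congr 1
  ext τ
  exact and_congr_right fun _ => ⟨fun h => by linarith, fun h => by linarith⟩

theorem continuous_merit {n k m : ℕ} [NeZero k] (c : Fin k → Fin n → ℝ) (d : Fin k → ℝ)
    (A : Fin m → Matrix (Fin n) (Fin n) ℝ) (b : Fin m → Fin n → ℝ) (lam : ℝ) (l : Fin m) :
    Continuous fun x => merit c d A b lam x l := by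
  refine Continuous.finset_inf'_apply _ fun i _ => ?_
  simp only [meritPiece_eq]
  have hB := continuous_Bmax c d
  have hφ : Continuous fun x : Fin n → ℝ => c i ⬝ᵥ x := continuous_const.dotProduct continuous_id
  have hψ : Continuous fun x : Fin n → ℝ => c i ⬝ᵥ (A l *ᵥ x + b l) :=
    continuous_const.dotProduct
      ((continuous_const.matrix_mulVec continuous_id).add continuous_const)
  fun_prop

/-- for each mode l, the set of states x with B(x) ≤ 0 on which l maximizes
the merit function (i.e. σ⁻¹(l) intersected with {B ≤ 0}) is closed. -/
theorem argmax_merit_closed {n k m : ℕ} [NeZero k] (c : Fin k → Fin n → ℝ) (d : Fin k → ℝ)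
    (A : Fin m → Matrix (Fin n) (Fin n) ℝ) (b : Fin m → Fin n → ℝ)
    (lam : ℝ) (hlam : 0 ≤ lam) (l : Fin m) :
    IsClosed {x : Fin n → ℝ | Bmax c d x ≤ 0 ∧
      ∀ l' : Fin m, merit c d A b lam x l' ≤ merit c d A b lam x l} := by
  simp only [Set.ofPred_and, Set.ofPred_forall]
  exact (isClosed_le (continuous_Bmax c d) continuous_const).inter <|
    isClosed_iInter fun l' =>
      isClosed_le (continuous_merit c d A b lam l') (continuous_merit c d A b lam l)
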